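/- (Klee) Let k be even and 2 ≤ n₁ ≤ n₂. Suppose there exists an (n₁, k−1) circuit code of length N¹ ≥ 2k with N¹ divisible by k, and an (n₂, k) circuit code of length N² ≥ 2k. If k = 2, then there exists an (n₁ + n₂, 2) circuit code of length N¹·N²/2. If k ≥ 4, then there exists an (n₁ + n₂ + 1, k) circuit code of length N¹·(N² + 2)/k. -/

import Mathlib

/-- The cyclic distance between two positions on a cycle of length `N`:
the minimum of the two arc lengths. -/
def cycDist {N : ℕ} (i j : ZMod N) : ℕ := min (j - i).val (i - j).val

/-- `C` is an `(n,k)` circuit code of length `N`: a cyclic sequence of `N` distinct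
vertices of the hypercube `I(n)` forming an induced cycle such that vertices at
Hamming distance `< k` are at equal cyclic distance. -/
structure IsCircuitCode (n k N : ℕ) (C : ZMod N → (Fin n → Bool)) : Prop where
  inj : Function.Injective C
  adj : ∀ i : ZMod N, hammingDist (C i) (C (i + 1)) = 1
  induced : ∀ i j : ZMod N, i ≠ j → j ≠ i + 1 → i ≠ j + 1 →
    hammingDist (C i) (C j) ≠ 1
  spread : ∀ i j : ZMod N, hammingDist (C i) (C j) < k →
    cycDist i j = hammingDist (C i) (C j)

/-- There exists an `(n,k)` circuit code of length `N`. -/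
def ExistsCircuitCode (n k N : ℕ) : Prop :=
  ∃ C : ZMod N → (Fin n → Bool), IsCircuitCode n k N C

/-- `K n k` is the maximum length of an `(n,k)` circuit code. -/
noncomputable def K (n k : ℕ) : ℕ := sSup {N | ExistsCircuitCode n k N}

section HammingCube

variable {n : ℕ}

theorem even_hammingDist_triangle (a b c : Fin n → Bool) :
    Even (hammingDist a b + hammingDist b c + hammingDist a c) := by
  simp only [hammingDist, Finset.card_filter, ← Finset.sum_add_distrib]
  refine Finset.even_sum _ fun i _ => ?_
  cases a i <;> cases b i <;> cases c i <;> decide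

theorem hammingDist_append {m : ℕ} (a b : Fin n → Bool) (c d : Fin m → Bool) :
    hammingDist (Fin.append a c) (Fin.append b d) = hammingDist a b + hammingDist c d := by
  simp [hammingDist, Finset.card_filter, Fin.sum_univ_add]

theorem hammingDist_snoc (a b : Fin n → Bool) (x y : Bool) :
    hammingDist (Fin.snoc a x : Fin (n + 1) → Bool) (Fin.snoc b y) =
      hammingDist a b + if x = y then 0 else 1 := by
  simp [hammingDist, Finset.card_filter, Fin.sum_univ_castSucc]

/-- The automorphism group of the hypercube is transitive on pairs at a given distance. -/
theorem exists_isometry_of_hammingDist_eq (x y x' y' : Fin n → Bool)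
    (h : hammingDist x y = hammingDist x' y') :
    ∃ g : (Fin n → Bool) → (Fin n → Bool),
      (∀ a b, hammingDist (g a) (g b) = hammingDist a b) ∧ g x = x' ∧ g y = y' := by
  have hc : Fintype.card {i // x' i ≠ y' i} = Fintype.card {i // x i ≠ y i} := by
    simpa [Fintype.card_subtype, hammingDist] using h.symm
  let σ := (Fintype.equivOfCardEq hc).extendSubtype
  refine ⟨fun v i => xor (v (σ i)) (xor (x (σ i)) (x' i)), fun a b => ?_, ?_, ?_⟩
  · simp only [hammingDist, Finset.card_filter]
    rw [← Equiv.sum_comp σ fun i => if a i ≠ b i then 1 else 0]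
    simp
  · funext i
    simp
  · funext i
    by_cases hi : x' i ≠ y' i
    · have := (Fintype.equivOfCardEq hc).extendSubtype_mem i hi
      change x (σ i) ≠ y (σ i) at this
      dsimp only
      revert this hi
      cases x (σ i) <;> cases y (σ i) <;> cases x' i <;> cases y' i <;> simp
    · have := (Fintype.equivOfCardEq hc).extendSubtype_not_mem i hi
      change ¬ x (σ i) ≠ y (σ i) at this
      dsimp only
      revert this hi
      cases x (σ i) <;> cases y (σ i) <;> cases x' i <;> cases y' i <;> simp

theorem hammingDist_le_of_steps {f : ℕ → Fin n → Bool} {N p q : ℕ}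
    (h : ∀ i < N, hammingDist (f i) (f (i + 1)) = 1) (hpq : p ≤ q) (hq : q ≤ N) :
    hammingDist (f p) (f q) ≤ q - p := by
  induction q, hpq using Nat.le_induction with
  | base => simp
  | succ q hpq ih =>
    have := hammingDist_triangle (f p) (f q) (f (q + 1))
    have := h q (by omega)
    have := ih (by omega)
    omega

theorem hammingDist_mod_two_of_steps {f : ℕ → Fin n → Bool}
    (h : ∀ i, hammingDist (f i) (f (i + 1)) = 1) (p t : ℕ) :
    hammingDist (f p) (f (p + t)) % 2 = t % 2 := by
  induction t with
  | zero => simp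
  | succ t ih =>
    have := even_hammingDist_triangle (f p) (f (p + t)) (f (p + t + 1))
    rw [h, Nat.even_iff] at this
    rw [← Nat.add_assoc]
    omega

end HammingCube

theorem cycDist_natCast {N x y : ℕ} (hxy : x ≤ y) (hy : y < x + N) :
    cycDist (x : ZMod N) (y : ZMod N) = min (y - x) (N - (y - x)) := by
  obtain ⟨t, rfl⟩ := Nat.exists_eq_add_of_le hxy
  have ht : t < N := by omega
  have : NeZero N := ⟨by omega⟩
  unfold cycDist
  have h1 : ((x + t : ℕ) : ZMod N) - x = (t : ℕ) := by push_cast; ring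
  have h2 : (x : ZMod N) - ((x + t : ℕ) : ZMod N) = -(t : ℕ) := by push_cast; ring
  rw [h1, h2, ZMod.neg_val, ZMod.val_natCast_of_lt ht]
  split_ifs with h0
  · have := congrArg ZMod.val h0
    rw [ZMod.val_natCast_of_lt ht, ZMod.val_zero] at this
    simp [this]
  · congr 1 <;> omega

/-- A closed walk of spread `k` in the hypercube, indexed by natural numbers, yields a
circuit code. -/
theorem existsCircuitCode_of_closedWalk {n k T : ℕ} (hk : 2 ≤ k) (hT : 1 < T)
    (f : ℕ → Fin n → Bool) (hper : f T = f 0)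
    (hadj : ∀ p < T, hammingDist (f p) (f (p + 1)) = 1)
    (hspread : ∀ p q, p < q → q < T → hammingDist (f p) (f q) < k →
      q - p ≤ hammingDist (f p) (f q) ∨ T - (q - p) ≤ hammingDist (f p) (f q)) :
    ExistsCircuitCode n k T := by
  have : NeZero T := ⟨by omega⟩
  have : Fact (1 < T) := ⟨hT⟩
  have key : ∀ p q, p ≤ q → q < T → hammingDist (f p) (f q) < k →
      min (q - p) (T - (q - p)) = hammingDist (f p) (f q) := by
    intro p q hpq hq hd
    have h1 := hammingDist_le_of_steps hadj hpq hq.le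
    have h2 := hammingDist_le_of_steps hadj (Nat.zero_le p) (by omega)
    have h3 := hammingDist_le_of_steps hadj hq.le le_rfl
    have h4 := hammingDist_triangle (f p) (f 0) (f q)
    rw [hper, hammingDist_comm (f q)] at h3
    rw [hammingDist_comm (f p) (f 0)] at h4
    rcases hpq.eq_or_lt with rfl | hlt
    · simp
    · have := hspread p q hlt hq hd
      omega
  have spread : ∀ i j : ZMod T, hammingDist (f i.val) (f j.val) < k →
      cycDist i j = hammingDist (f i.val) (f j.val) := by
    intro i j hd
    have hi := i.val_lt
    have hj := j.val_lt
    rcases le_total i.val j.val with hij | hij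
    · have := cycDist_natCast (N := T) hij (by omega)
      simp only [ZMod.natCast_val, ZMod.cast_id', id] at this
      rw [this, key _ _ hij hj hd]
    · have := cycDist_natCast (N := T) hij (by omega)
      simp only [ZMod.natCast_val, ZMod.cast_id', id] at this
      rw [hammingDist_comm] at hd ⊢
      rw [cycDist, min_comm, ← cycDist, this, key _ _ hij hi hd]
  have val_sub_eq : ∀ i j : ZMod T, ∀ c, cycDist i j = c →
      (j - i).val = c ∨ (i - j).val = c := by
    intro i j c h
    unfold cycDist at h
    omega
  refine ⟨fun i => f i.val, ?_, ?_, ?_, spread⟩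
  · intro i j hij
    have hij : f i.val = f j.val := hij
    have h := spread i j (by rw [hij, hammingDist_self]; omega)
    rw [hij, hammingDist_self] at h
    rcases val_sub_eq _ _ _ h with h | h
    · exact (sub_eq_zero.mp ((ZMod.val_eq_zero _).mp h)).symm
    · exact sub_eq_zero.mp ((ZMod.val_eq_zero _).mp h)
  · intro i
    have hi := i.val_lt
    rw [ZMod.val_add, ZMod.val_one]
    rcases Nat.lt_or_ge (i.val + 1) T with h | h
    · rw [Nat.mod_eq_of_lt h, hadj _ hi]
    · have h : i.val + 1 = T := by omega
      rw [h, Nat.mod_self, ← hper, ← hadj _ hi, h]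
  · intro i j _ h2 h3 hd
    have h := spread i j (by change hammingDist (f i.val) (f j.val) = 1 at hd; omega)
    rw [show hammingDist (f i.val) (f j.val) = 1 from hd] at h
    have h1 : ∀ a : ZMod T, a.val = 1 → a = 1 := fun a ha =>
      ZMod.val_injective T (by rw [ha, ZMod.val_one])
    rcases val_sub_eq _ _ _ h with h | h
    · exact h2 (by rw [← h1 _ h]; ring)
    · exact h3 (by rw [← h1 _ h]; ring)

/-- The product walk: it alternates `k` steps along the closed walk `u` of length `m * k` in the
first factor with the `s` steps of the path `P j` in the second factor. -/
theorem existsCircuitCode_of_product {n w k m s : ℕ} (hk : 2 ≤ k) (hm : 2 ≤ m)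
    (u : ℕ → Fin n → Bool) (P : ℕ → ℕ → Fin w → Bool)
    (hu_per : u (m * k) = u 0)
    (hu_loc : ∀ x y, x ≤ y → y ≤ x + k → hammingDist (u x) (u y) = y - x)
    (hu_far : ∀ j j', j < j' → j' < j + m → k ≤ hammingDist (u (j * k)) (u (j' * k)))
    (hP_per : P m 0 = P 0 0)
    (hP_succ : ∀ j, P j s = P (j + 1) 0)
    (hP_adj : ∀ j, ∀ a < s, hammingDist (P j a) (P j (a + 1)) = 1)
    (hP_spread : ∀ j a b, a ≤ b → b ≤ s → hammingDist (P j a) (P j b) < k →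
      hammingDist (P j a) (P j b) = b - a)
    (hP_far : ∀ j j', j < j' → j' < j + m → k ≤ hammingDist (P j 0) (P j' 0))
    (hmix : ∀ j l r a, j < m → l < m → r ≤ k → 0 < a → a < s → l ≠ j → l + 1 ≠ j →
      ¬ (j = 0 ∧ l + 1 = m) →
      k ≤ hammingDist (u (j * k + r)) (u ((l + 1) * k)) + hammingDist (P j 0) (P l a)) :
    ExistsCircuitCode (n + w) k (m * (k + s)) := by
  set B := k + s with hB
  have hB0 : 0 < B := by omega
  let F : ℕ → ℕ → Fin (n + w) → Bool := fun j r =>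
    if r ≤ k then Fin.append (u (j * k + r)) (P j 0) else Fin.append (u ((j + 1) * k)) (P j (r - k))
  have hF1 : ∀ j r, r ≤ k → F j r = Fin.append (u (j * k + r)) (P j 0) := fun j r h => if_pos h
  have hF2 : ∀ j r, k ≤ r → F j r = Fin.append (u ((j + 1) * k)) (P j (r - k)) := by
    intro j r h
    rcases h.eq_or_lt with rfl | h
    · rw [hF1 _ _ le_rfl, Nat.sub_self, Nat.succ_mul]
    · exact if_neg (by omega)
  have hF3 : ∀ j, F j B = F (j + 1) 0 := by
    intro j
    rw [hF2 _ _ (by omega), hF1 _ _ (Nat.zero_le k), hB, Nat.add_sub_cancel_left, hP_succ,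
      Nat.add_zero ((j + 1) * k)]
  have hF4 : ∀ j r, r < B → hammingDist (F j r) (F j (r + 1)) = 1 := by
    intro j r hr
    rcases Nat.lt_or_ge r k with h | h
    · rw [hF1 _ _ h.le, hF1 _ _ h, hammingDist_append, hammingDist_self,
        hu_loc _ _ (by omega) (by omega)]
      omega
    · rw [hF2 _ _ h, hF2 _ _ (by omega), hammingDist_append, hammingDist_self,
        show r + 1 - k = r - k + 1 by omega, hP_adj _ _ (by omega)]
  have hdiv : ∀ j r, r < B → (j * B + r) / B = j ∧ (j * B + r) % B = r := by
    intro j r hr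
    rw [Nat.add_comm, Nat.add_mul_div_right _ _ hB0, Nat.add_mul_mod_self_right,
      Nat.div_eq_of_lt hr, Nat.mod_eq_of_lt hr, Nat.zero_add]
    exact ⟨rfl, rfl⟩
  have hf : ∀ j r, r ≤ B → F ((j * B + r) / B) ((j * B + r) % B) = F j r := by
    intro j r hr
    rcases hr.eq_or_lt with rfl | hr
    · have := hdiv (j + 1) 0 hB0
      rw [Nat.add_zero, Nat.succ_mul] at this
      rw [this.1, this.2, hF3]
    · rw [(hdiv j r hr).1, (hdiv j r hr).2]
  refine existsCircuitCode_of_closedWalk hk (by nlinarith) (fun p => F (p / B) (p % B)) ?_ ?_ ?_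
  · have := hf m 0 (by omega)
    rw [Nat.add_zero] at this
    rw [this, Nat.zero_div, Nat.zero_mod, hF1 _ _ (by omega), hF1 _ _ (by omega)]
    simp [hu_per, hP_per]
  · intro p _
    have hr := Nat.mod_lt p hB0
    have h1 := hf (p / B) (p % B + 1) hr
    rw [← Nat.add_assoc, Nat.div_add_mod'] at h1
    rw [h1, hF4 _ _ hr]
  · intro p q hpq hq
    obtain ⟨j, r, hr, hjm, rfl⟩ : ∃ j r, r < B ∧ j < m ∧ p = j * B + r :=
      ⟨p / B, p % B, Nat.mod_lt _ hB0, Nat.div_lt_of_lt_mul (by rw [Nat.mul_comm]; omega),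
        (Nat.div_add_mod' _ _).symm⟩
    obtain ⟨j', r', hr', hjm', rfl⟩ : ∃ j r, r < B ∧ j < m ∧ q = j * B + r :=
      ⟨q / B, q % B, Nat.mod_lt _ hB0, Nat.div_lt_of_lt_mul (by rw [Nat.mul_comm]; omega),
        (Nat.div_add_mod' _ _).symm⟩
    rw [hf _ _ hr.le, hf _ _ hr'.le]
    have hjj' : j ≤ j' := by
      by_contra! h
      have : (j' + 1) * B ≤ j * B := Nat.mul_le_mul_right _ h
      rw [Nat.succ_mul] at this
      omega
    rcases Nat.lt_or_ge k r with hrk | hrk <;> rcases Nat.lt_or_ge k r' with hrk' | hrk'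
    · rw [hF2 _ _ hrk.le, hF2 _ _ hrk'.le, hammingDist_append]
      intro hd
      rcases hjj'.eq_or_lt with rfl | hlt
      · have := hP_spread j (r - k) (r' - k) (by omega) (by omega) (by omega)
        omega
      · have := hu_far (j + 1) (j' + 1) (by omega) (by omega)
        omega
    · rw [hF2 _ _ hrk.le, hF1 _ _ hrk', hammingDist_append]
      intro hd
      have hlt : j < j' := by
        refine lt_of_le_of_ne hjj' ?_
        rintro rfl
        omega
      by_cases h1 : j' = j + 1
      · subst h1
        rw [← hP_succ] at hd ⊢
        have e1 := hu_loc ((j + 1) * k) ((j + 1) * k + r') (by omega) (by omega)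
        have e2 := hP_spread j (r - k) s (by omega) (by omega) (by omega)
        left
        rw [e1, e2, Nat.succ_mul]
        omega
      · have := hmix j' j r' (r - k) hjm' hjm hrk' (by omega) (by omega) (by omega) (by omega)
          (by omega)
        rw [hammingDist_comm (u _), hammingDist_comm (P _ _)] at this
        omega
    · rw [hF1 _ _ hrk, hF2 _ _ hrk'.le, hammingDist_append]
      intro hd
      rcases hjj'.eq_or_lt with rfl | hlt
      · have e1 := hu_loc (j * k + r) ((j + 1) * k) (by rw [Nat.succ_mul]; omega)
          (by rw [Nat.succ_mul]; omega)
        have e2 := hP_spread j 0 (r' - k) (by omega) (by omega) (by omega)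
        left
        rw [e1, e2, Nat.succ_mul]
        omega
      · by_cases h1 : j = 0 ∧ j' + 1 = m
        · obtain ⟨rfl, h1⟩ := h1
          rw [h1, hu_per, ← hP_per, ← h1, ← hP_succ, hammingDist_comm (u _),
            hammingDist_comm (P _ _)] at hd ⊢
          have e1 := hu_loc 0 (0 * k + r) (by omega) (by omega)
          have e2 := hP_spread j' (r' - k) s (by omega) (by omega) (by omega)
          right
          rw [e1, e2, Nat.succ_mul]
          omega
        · have := hmix j j' r (r' - k) hjm hjm' hrk (by omega) (by omega) (by omega) (by omega) h1
          omega
    · rw [hF1 _ _ hrk, hF1 _ _ hrk', hammingDist_append]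
      intro hd
      rcases hjj'.eq_or_lt with rfl | hlt
      · have := hu_loc (j * k + r) (j * k + r') (by omega) (by omega)
        omega
      · have := hP_far j j' hlt (by omega)
        omega

namespace IsCircuitCode

variable {n k N : ℕ} {C : ZMod N → Fin n → Bool}

theorem adj_natCast (h : IsCircuitCode n k N C) (i : ℕ) :
    hammingDist (C (i : ℕ)) (C ((i + 1 : ℕ) : ZMod N)) = 1 := by
  rw [Nat.cast_succ]
  exact h.adj i

theorem le_hammingDist (h : IsCircuitCode n k N C) {d x y : ℕ} (hd : d ≤ k)
    (h1 : x + d ≤ y) (h2 : y + d ≤ x + N) : d ≤ hammingDist (C (x : ℕ)) (C (y : ℕ)) := by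
  rcases Nat.eq_zero_or_pos d with rfl | hpos
  · omega
  by_contra! hlt
  have h3 := h.spread x y (by omega)
  rw [cycDist_natCast (by omega) (by omega)] at h3
  omega

theorem hammingDist_eq_sub (h : IsCircuitCode n k N C) {x y : ℕ} (hxy : x ≤ y) (hk : y ≤ x + k)
    (hN : 2 * k ≤ N) : hammingDist (C (x : ℕ)) (C (y : ℕ)) = y - x := by
  have h1 := h.le_hammingDist (d := y - x) (x := x) (y := y) (by omega) (by omega) (by omega)
  have h2 := hammingDist_le_of_steps (f := fun i : ℕ => C i) (N := y)
    (fun i _ => h.adj_natCast i) hxy le_rfl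
  exact le_antisymm h2 h1

/-- Parity improves the distance bound of a code of odd spread `k - 1` between vertices at even
offset. -/
theorem le_hammingDist_of_even (h : IsCircuitCode n (k - 1) N C) (hk : Even k) {x t : ℕ}
    (ht : Even t) (h1 : k ≤ t) (h2 : t + k ≤ N) :
    k ≤ hammingDist (C (x : ℕ)) (C ((x + t : ℕ) : ZMod N)) := by
  have h3 := h.le_hammingDist (d := k - 1) (x := x) (y := x + t) le_rfl (by omega) (by omega)
  have h4 := hammingDist_mod_two_of_steps (f := fun i : ℕ => C i) h.adj_natCast x t
  rw [Nat.even_iff] at hk ht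
  omega

theorem hammingDist_eq_sub_of_even (h : IsCircuitCode n (k - 1) N C) (hk : Even k) {x y : ℕ}
    (hxy : x ≤ y) (hyk : y ≤ x + k) (hN : 2 * k ≤ N) :
    hammingDist (C (x : ℕ)) (C (y : ℕ)) = y - x := by
  rcases Nat.lt_or_ge y (x + k) with hlt | hge
  · exact h.hammingDist_eq_sub hxy (by omega) (by omega)
  · obtain rfl : y = x + k := by omega
    have h1 := h.le_hammingDist_of_even hk (x := x) hk le_rfl (by omega)
    have h2 := hammingDist_le_of_steps (f := fun i : ℕ => C i) (N := x + k)
      (fun i _ => h.adj_natCast i) hxy le_rfl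
    omega

theorem spread_two (h : IsCircuitCode n 1 N C) : IsCircuitCode n 2 N C := by
  refine ⟨h.inj, h.adj, h.induced, fun i j hd => ?_⟩
  rcases Nat.lt_or_ge (hammingDist (C i) (C j)) 1 with h0 | h0
  · exact h.spread i j h0
  have h1 : hammingDist (C i) (C j) = 1 := by omega
  have hne : i ≠ j := by
    rintro rfl
    simp at h1
  have hN : N ≠ 1 := by
    rintro rfl
    exact hne (Subsingleton.elim _ _)
  have h01 : ∀ a : ZMod N, cycDist a (a + 1) = 1 := by
    intro a
    unfold cycDist
    rcases Nat.eq_zero_or_pos N with rfl | hpos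
    · simp [ZMod.val]
    have : Fact (1 < N) := ⟨by omega⟩
    rw [add_sub_cancel_left, sub_add_cancel_left, ZMod.val_one]
    have : (-1 : ZMod N).val ≠ 0 := by simp
    omega
  rw [h1]
  by_cases h2 : j = i + 1
  · rw [h2, h01]
  by_cases h3 : i = j + 1
  · rw [h3, cycDist, min_comm, ← cycDist, h01]
  · exact absurd h1 (h.induced i j hne h2 h3)

/-- The long arc between two vertices of a circuit code at cyclic distance `k` can be moved so
that it joins any two prescribed vertices at distance `k`. -/
theorem exists_arc (h : IsCircuitCode n k N C) (hN : 2 * k ≤ N) (x y : Fin n → Bool)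
    (hxy : hammingDist x y = k) :
    ∃ v : ℕ → Fin n → Bool, v 0 = x ∧ v (N - k) = y ∧
      (∀ a, hammingDist (v a) (v (a + 1)) = 1) ∧
      ∀ a b, a ≤ b → b ≤ N - k → hammingDist (v a) (v b) < k →
        hammingDist (v a) (v b) = b - a := by
  have hd := h.hammingDist_eq_sub (x := N - k) (y := N) (by omega) (by omega) hN
  rw [ZMod.natCast_self, hammingDist_comm, ← Nat.cast_zero (R := ZMod N)] at hd
  obtain ⟨g, hg, hx, hy⟩ := exists_isometry_of_hammingDist_eq (C (0 : ℕ)) (C (N - k : ℕ)) x y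
    (by omega)
  refine ⟨fun a => g (C (a : ℕ)), hx, hy, fun a => ?_, fun a b hab hb hlt => ?_⟩
  · rw [hg, h.adj_natCast]
  · rw [hg] at hlt ⊢
    have := h.spread a b hlt
    rcases Nat.eq_zero_or_pos k with rfl | hpos
    · omega
    rw [cycDist_natCast hab (by omega)] at this
    omega

end IsCircuitCode

theorem stmt_11 (k n₁ n₂ N₁ N₂ : ℕ) (hkeven : Even k) (hn₁ : 2 ≤ n₁) (hn₁₂ : n₁ ≤ n₂)
    (h₁ : ExistsCircuitCode n₁ (k - 1) N₁) (hN₁ : 2 * k ≤ N₁) (hdvd : k ∣ N₁)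
    (h₂ : ExistsCircuitCode n₂ k N₂) (hN₂ : 2 * k ≤ N₂) :
    (k = 2 → ExistsCircuitCode (n₁ + n₂) 2 (N₁ * N₂ / 2)) ∧
    (4 ≤ k → ExistsCircuitCode (n₁ + n₂ + 1) k (N₁ * (N₂ + 2) / k)) := by
  rcases Nat.lt_or_ge k 2 with hk2 | hk2
  · exact ⟨by omega, by omega⟩
  obtain ⟨C₁, h₁⟩ := h₁
  obtain ⟨C₂, h₂⟩ := h₂
  obtain ⟨m, rfl⟩ := hdvd
  obtain ⟨c, rfl⟩ := Nat.exists_eq_add_of_le hn₁₂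
  have hm : 2 ≤ m := by
    by_contra! hlt
    have : k * m ≤ k * 1 := Nat.mul_le_mul_left _ (by omega)
    omega
  let u : ℕ → Fin n₁ → Bool := fun x => C₁ (x : ℕ)
  let τ : ℕ → Fin (n₁ + c) → Bool := fun j => Fin.append (u (j * k)) fun _ => false
  have hτd : ∀ i j, hammingDist (τ i) (τ j) = hammingDist (u (i * k)) (u (j * k)) := by
    intro i j
    simp only [τ, hammingDist_append, hammingDist_self, Nat.add_zero]
  have hu_per : u (m * k) = u 0 := by
    have h : ((m * k : ℕ) : ZMod (k * m)) = (0 : ℕ) := by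
      simp [Nat.mul_comm m k]
    exact congrArg C₁ h
  have hu_loc : ∀ x y, x ≤ y → y ≤ x + k → hammingDist (u x) (u y) = y - x :=
    fun x y hxy hy => h₁.hammingDist_eq_sub_of_even hkeven hxy hy hN₁
  have hu_far : ∀ j j', j < j' → j' < j + m → k ≤ hammingDist (u (j * k)) (u (j' * k)) := by
    intro j j' hlt hlt'
    obtain ⟨t, rfl⟩ := Nat.exists_eq_add_of_lt hlt
    have e : (j + t + 1) * k = j * k + (t + 1) * k := by ring
    have h3 : (t + 2) * k ≤ m * k := Nat.mul_le_mul_right _ (by omega)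
    simp only [u]
    rw [e]
    exact h₁.le_hammingDist_of_even hkeven (hkeven.mul_left _) (by nlinarith)
      (by rw [Nat.mul_comm k m]; linarith)
  have hτ_far : ∀ j j', j < j' → j' < j + m → k ≤ hammingDist (τ j) (τ j') := by
    intro j j' h h'
    rw [hτd]
    exact hu_far j j' h h'
  have hτ_per : τ m = τ 0 := by
    simp only [τ, hu_per, Nat.zero_mul]
  have hu_mix : ∀ d j l r, d ≤ k → IsCircuitCode n₁ d (k * m) C₁ → j < m → l < m → r ≤ k →
      l ≠ j → l + 1 ≠ j → ¬ (j = 0 ∧ l + 1 = m) →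
      d ≤ hammingDist (u (j * k + r)) (u ((l + 1) * k)) := by
    intro d j l r hd hC hj hl hr h1 h2 h3
    rw [not_and_or] at h3
    have hle : ∀ a b, a ≤ b → a * k ≤ b * k := fun a b h => Nat.mul_le_mul_right _ h
    have hcomm := Nat.mul_comm k m
    rcases Nat.lt_or_ge l j with hlt | hge
    · rw [hammingDist_comm]
      have e1 := hle (l + 2) j (by omega)
      have e3 := hle (j + 2) (l + 1 + m) (by omega)
      simp only [Nat.add_mul, Nat.one_mul] at e1 e3
      exact hC.le_hammingDist le_rfl (by rw [Nat.succ_mul]; omega) (by rw [Nat.succ_mul]; omega)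
    · have e1 := hle (j + 2) (l + 1) (by omega)
      have e3 := hle (l + 2) (j + m) (by omega)
      simp only [Nat.add_mul, Nat.one_mul] at e1 e3
      exact hC.le_hammingDist le_rfl (by rw [Nat.succ_mul]; omega) (by rw [Nat.succ_mul]; omega)
  have harc := fun j => h₂.exists_arc hN₂ (τ j) (τ (j + 1)) (by
    rw [hτd, hu_loc _ _ (by rw [Nat.succ_mul]; omega) (by rw [Nat.succ_mul])]
    rw [Nat.succ_mul]
    omega)
  choose v hv0 hv1 hv_adj hv_spread using harc
  constructor
  · rintro rfl
    have e : 2 * m * N₂ / 2 = m * (2 + (N₂ - 2)) := by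
      rw [Nat.mul_assoc, Nat.mul_div_cancel_left _ two_pos]
      congr 1
      omega
    rw [e]
    refine existsCircuitCode_of_product le_rfl hm u v hu_per hu_loc hu_far ?_ ?_
      (fun j a _ => hv_adj j a) hv_spread ?_ ?_
    · rw [hv0, hv0, hτ_per]
    · intro j
      rw [hv0, hv1]
    · intro j j'
      rw [hv0, hv0]
      exact hτ_far j j'
    · intro j l r a hj hl hr _ _ h1 h2 h3
      exact (hu_mix 2 j l r le_rfl h₁.spread_two hj hl hr h1 h2 h3).trans (Nat.le_add_right _ _)
  · intro hk4
    have e : k * m * (N₂ + 2) / k = m * (k + (N₂ - k + 2)) := by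
      rw [Nat.mul_assoc, Nat.mul_div_cancel_left _ (by omega)]
      congr 1
      omega
    rw [e, Nat.add_assoc n₁]
    let P : ℕ → ℕ → Fin (n₁ + c + 1) → Bool := fun j a =>
      Fin.snoc (v j (min (a - 1) (N₂ - k))) (decide (a = 0 ∨ a = N₂ - k + 2))
    have hPd : ∀ j j' a b, hammingDist (P j a) (P j' b) =
        hammingDist (v j (min (a - 1) (N₂ - k))) (v j' (min (b - 1) (N₂ - k))) +
          if (a = 0 ∨ a = N₂ - k + 2 ↔ b = 0 ∨ b = N₂ - k + 2) then 0 else 1 := by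
      intro j j' a b
      simp only [P, hammingDist_snoc, decide_eq_decide]
    have hP0 : ∀ j, P j 0 = Fin.snoc (τ j) true := by
      intro j
      simp [P, hv0]
    refine existsCircuitCode_of_product hk2 hm u P hu_per hu_loc hu_far ?_ ?_ ?_ ?_ ?_ ?_
    · rw [hP0, hP0, hτ_per]
    · intro j
      rw [hP0]
      simp [P, hv1]
    · intro j a ha
      rw [hPd]
      rcases Nat.eq_zero_or_pos a with rfl | hpos
      · simp
      rcases Nat.lt_or_ge a (N₂ - k + 1) with hlt | hge
      · rw [if_pos (by omega), min_eq_left (by omega), min_eq_left (by omega),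
          show a + 1 - 1 = a - 1 + 1 by omega, hv_adj]
      · rw [if_neg (by omega), min_eq_right (by omega), min_eq_right (by omega), hammingDist_self]
    · intro j a b hab hb hlt
      rw [hPd] at hlt ⊢
      have hs := hv_spread j (min (a - 1) (N₂ - k)) (min (b - 1) (N₂ - k)) (by omega) (by omega)
        (by omega)
      rw [hs] at hlt ⊢
      split_ifs at hlt ⊢ <;> omega
    · intro j j' h h'
      rw [hP0, hP0, hammingDist_snoc]
      exact (hτ_far j j' h h').trans (Nat.le_add_right _ _)
    · intro j l r a hj hl hr ha0 has h1 h2 h3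
      have e1 := hu_mix (k - 1) j l r (by omega) h₁ hj hl hr h1 h2 h3
      rw [hPd, if_neg (by omega)]
      omega
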